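/- arXiv:1907.02049 — 2 statements merged into one kernel-verified Lean document; each statement's English description precedes it below -/
import Mathlib

section
/- Let d ≥ h+1 and h ≥ 1 be integers and ε, c > 0, and set Q = N^{ε/(2d)}. There exists a constant C₃ = C₃(d,h,ε,c), which may be taken to be C₃ = (2^d/c)^{1/(d−h−1+ε/2)}, such that if N ≥ C₃ and S ⊆ {x ∈ O_K^d : max_i H_K(x_i) ≤ N} has |S| ≥ c·N^{d−h−1+ε}, then there exist an index 1 ≤ i ≤ d and a subset S̃ ⊆ S with |S̃| ≥ |S|/2^d such that every subset A ⊆ S̃ with |A| ≥ |S̃|/2 satisfies |π_i(A)| ≥ Q, where π_i is the projection onto the i-th coordinate. -/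
open scoped BigOperators

noncomputable section

/-- Abstract data of a global field `K`: a field of degree `dK` over its base field
`𝕜` (`𝕜 = ℚ` or `𝔽_q(T)`), together with its set of places and normalized absolute
values `‖·‖_v`.  The heights, the ring of integers and the primes appearing in the
statements are derived from this data. -/
structure GlobalFieldData : Type 1 where
  /-- the global field -/
  K : Type
  /-- `K` is a field -/
  [instField : Field K]
  /-- the base field `𝕜 = ℚ` or `𝔽_q(T)`, as a subfield of `K` -/
  k0 : Subfield K
  /-- the degree `d_K = [K : 𝕜]` of `K` over its base field -/
  dK : ℕ
  dK_pos : 0 < dK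
  /-- whether `K` is a number field (otherwise it is a function field over `𝔽_q`) -/
  isNumberField : Prop
  /-- the places of `K` -/
  Place : Type
  /-- the normalized absolute value `‖·‖_v` attached to each place `v` -/
  av : Place → AbsoluteValue K ℝ
  /-- the distinguished places: the archimedean places `M_{K,∞}` when `K` is a number
  field, and the places used to define the ring of integers `O_K` when `K` is a
  function field -/
  infPlaces : Set Place
  /-- away from the distinguished places, the absolute values are non-archimedean -/
  nonarch : ∀ v ∉ infPlaces, ∀ x y : K, av v (x + y) ≤ max (av v x) (av v y)

attribute [instance] GlobalFieldData.instField

namespace GlobalFieldData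

variable (G : GlobalFieldData)

/-- The set of `S`-integers `O_{K,S} = { x ∈ K : ‖x‖_v ≤ 1 for all v ∉ S }`. -/
def SInt (S : Set G.Place) : Set G.K := {x : G.K | ∀ v ∉ S, G.av v x ≤ 1}

/-- The ring of integers `O_K` of the global field `K`. -/
def Oring : Subring G.K where
  carrier := {x : G.K | ∀ v ∉ G.infPlaces, G.av v x ≤ 1}
  one_mem' := fun v _ => le_of_eq ((G.av v).map_one)
  mul_mem' := fun {a b} ha hb v hv => by
    rw [(G.av v).map_mul]
    exact mul_le_one₀ (ha v hv) ((G.av v).nonneg b) (hb v hv)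
  add_mem' := fun {a b} ha hb v hv =>
    le_trans (G.nonarch v hv a b) (max_le (ha v hv) (hb v hv))
  zero_mem' := fun v _ => by rw [(G.av v).map_zero]; exact zero_le_one
  neg_mem' := fun {a} ha v hv => by
    rw [(G.av v).map_neg]
    exact ha v hv

/-- The absolute multiplicative projective height of a coordinate vector
`H(x₀ : ⋯ : x_{n-1}) = ∏_v max_i ‖x_i‖_v`. -/
def Hproj {n : ℕ} (x : Fin n → G.K) : ℝ := ∏ᶠ v : G.Place, ⨆ i, G.av v (x i)

/-- The absolute multiplicative height `H(x) = H(1 : x)` of a field element. -/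
def H (x : G.K) : ℝ := ∏ᶠ v : G.Place, max 1 (G.av v x)

/-- The relative multiplicative height `H_K = H^{d_K}`. -/
def HK (x : G.K) : ℝ := G.H x ^ G.dK

/-- The relative projective height `H_K(x₀ : ⋯ : x_{n-1})`. -/
def HKproj {n : ℕ} (x : Fin n → G.K) : ℝ := G.Hproj x ^ G.dK

/-- The relative affine height `H_K(1 : x₁ : ⋯ : x_n)`. -/
def HKaff {n : ℕ} (x : Fin n → G.K) : ℝ :=
  (∏ᶠ v : G.Place, max 1 (⨆ i, G.av v (x i))) ^ G.dK

/-- The primes `𝔭` of `O_K`: the maximal ideals of `O_K` (they have finite residue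
rings `O_K/𝔭`). -/
def Primes : Type := {p : Ideal G.Oring // p.IsMaximal ∧ Finite (G.Oring ⧸ p)}

/-- The norm `N_K(𝔭) = |O_K/𝔭|` of a prime. -/
def normP (p : G.Primes) : ℕ := Nat.card (G.Oring ⧸ p.1)

/-- Coordinatewise reduction modulo a prime `𝔭`. -/
def red (p : G.Primes) {n : ℕ} (x : Fin n → G.Oring) : Fin n → G.Oring ⧸ p.1 :=
  fun i => Ideal.Quotient.mk p.1 (x i)

/-- `𝒫(Q)`: the set of primes of norm at most `Q`. -/
def PQ (Q : ℝ) : Set G.Primes := {p : G.Primes | (G.normP p : ℝ) ≤ Q}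

/-- `w(P) = ∑_{𝔭 ∈ P} log(N_K(𝔭))/N_K(𝔭)`. -/
def w (P : Set G.Primes) : ℝ := ∑ᶠ p ∈ P, Real.log (G.normP p : ℝ) / (G.normP p : ℝ)

end GlobalFieldData

/-- A finite subset of a product has at most as many elements as the product of its
coordinate projections. -/
theorem Set.Finite.ncard_le_prod_ncard_image {ι α : Type*} [Fintype ι] {T : Set (ι → α)}
    (hT : T.Finite) : T.ncard ≤ ∏ i, ((fun x : ι → α => x i) '' T).ncard := by
  classical
  have hsub : hT.toFinset ⊆
      Fintype.piFinset fun i => (hT.image fun x : ι → α => x i).toFinset := by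
    intro x hx
    simp only [Fintype.mem_piFinset, Set.Finite.mem_toFinset] at hx ⊢
    exact fun i => ⟨x, hx, rfl⟩
  have hcard := Finset.card_le_card hsub
  rw [Fintype.card_piFinset] at hcard
  simpa only [← Set.ncard_eq_toFinset_card] using hcard

/-- If every large subset of `S` can be halved so that its projection to a prescribed coordinate
becomes small, then `S` has a large subset whose first `k` coordinate projections are small. -/
theorem exists_subset_forall_ncard_image_lt {α : Type*} {d : ℕ} {S : Set (Fin d → α)} {Q : ℝ}
    (hfin : S.Finite)
    (hstep : ∀ i : Fin d, ∀ T ⊆ S, (S.ncard : ℝ) / 2 ^ d ≤ (T.ncard : ℝ) →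
      ∃ A ⊆ T, (T.ncard : ℝ) / 2 ≤ (A.ncard : ℝ) ∧
        (((fun x : Fin d → α => x i) '' A).ncard : ℝ) < Q) (k : ℕ) (hk : k ≤ d) :
    ∃ T ⊆ S, (S.ncard : ℝ) / 2 ^ k ≤ (T.ncard : ℝ) ∧
      ∀ i : Fin d, (i : ℕ) < k → (((fun x : Fin d → α => x i) '' T).ncard : ℝ) < Q := by
  induction k with
  | zero => exact ⟨S, subset_rfl, by simp, fun i hi => absurd hi (Nat.not_lt_zero _)⟩
  | succ k ih =>
    obtain ⟨T, hTS, hT, hproj⟩ := ih (Nat.le_of_succ_le hk)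
    have hlarge : (S.ncard : ℝ) / 2 ^ d ≤ (T.ncard : ℝ) := by
      refine le_trans ?_ hT
      gcongr
      · norm_num
      · exact Nat.le_of_succ_le hk
    obtain ⟨A, hAT, hA, hAQ⟩ := hstep ⟨k, hk⟩ T hTS hlarge
    refine ⟨A, hAT.trans hTS, ?_, fun i hi => ?_⟩
    · rw [pow_succ, ← div_div]
      linarith
    · rcases Nat.lt_succ_iff_lt_or_eq.mp hi with hlt | heq
      · refine lt_of_le_of_lt ?_ (hproj i hlt)
        exact_mod_cast Set.ncard_le_ncard (Set.image_mono hAT) ((hfin.subset hTS).image _)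
      · obtain rfl : i = ⟨k, hk⟩ := Fin.ext heq
        exact hAQ

/-- A lower bound `B ^ (1 / e) ≤ N` on the base absorbs the constant `B` into a power of `N`. -/
theorem rpow_le_mul_rpow_div_of_rpow_one_div_le {M c N e s : ℝ} (hM : 0 < M) (hc : 0 < c)
    (he : 0 < e) (hN : (M / c) ^ (1 / e) ≤ N) : N ^ s ≤ c * N ^ (e + s) / M := by
  have hB : 0 < M / c := div_pos hM hc
  have hN0 : 0 < N := (Real.rpow_pos_of_pos hB _).trans_le hN
  have hpow : M / c ≤ N ^ e := by
    have := Real.rpow_le_rpow (Real.rpow_nonneg hB.le _) hN he.le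
    rwa [← Real.rpow_mul hB.le, one_div_mul_cancel he.ne', Real.rpow_one] at this
  rw [Real.rpow_add hN0, le_div_iff₀ hM]
  rw [div_le_iff₀ hc] at hpow
  nlinarith [mul_le_mul_of_nonneg_left hpow (Real.rpow_nonneg hN0.le s)]

open GlobalFieldData in
/-- **Claim 5.5** (large projections): if `N ≥ C₃ = (2^d/c)^{1/(d-h-1+ε/2)}` and
`S ⊆ {x ∈ O_K^d : max_i H_K(x_i) ≤ N}` has `|S| ≥ c·N^{d-h-1+ε}`, then there are a
coordinate `i` and a subset `S̃ ⊆ S` with `|S̃| ≥ |S|/2^d` such that every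
`A ⊆ S̃` with `|A| ≥ |S̃|/2` satisfies `|π_i(A)| ≥ Q = N^{ε/(2d)}`. -/
theorem large_projection_claim (G : GlobalFieldData) (d h : ℕ)
    (hh : 1 ≤ h) (hd : h + 1 ≤ d) (ε c : ℝ) (hε : 0 < ε) (hc : 0 < c)
    (N : ℝ)
    (hN : ((2 : ℝ) ^ d / c) ^ ((1 : ℝ) / ((d : ℝ) - (h : ℝ) - 1 + ε / 2)) ≤ N)
    (S : Set (Fin d → G.Oring)) (hfin : S.Finite)
    (hbox : ∀ x ∈ S, ∀ i, G.HK ((x i : G.Oring) : G.K) ≤ N)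
    (hsize : c * N ^ ((d : ℝ) - (h : ℝ) - 1 + ε) ≤ (S.ncard : ℝ)) :
    ∃ i : Fin d, ∃ T : Set (Fin d → G.Oring), T ⊆ S ∧
      (S.ncard : ℝ) / 2 ^ d ≤ (T.ncard : ℝ) ∧
      ∀ A : Set (Fin d → G.Oring), A ⊆ T → (T.ncard : ℝ) / 2 ≤ (A.ncard : ℝ) →
        N ^ (ε / (2 * (d : ℝ))) ≤ (((fun x : Fin d → G.Oring => x i) '' A).ncard : ℝ) := by
  have hd' : (h : ℝ) + 1 ≤ d := by exact_mod_cast hd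
  have hd0 : 0 < d := by omega
  have he : 0 < (d : ℝ) - (h : ℝ) - 1 + ε / 2 := by linarith
  have hN0 : 0 < N := (Real.rpow_pos_of_pos (by positivity) _).trans_le hN
  have hlow := rpow_le_mul_rpow_div_of_rpow_one_div_le (s := ε / 2)
    (by positivity : (0 : ℝ) < 2 ^ d) hc he hN
  rw [show (d : ℝ) - h - 1 + ε / 2 + ε / 2 = (d : ℝ) - h - 1 + ε by ring] at hlow
  by_contra! hcon
  obtain ⟨T, hTS, hT, hproj⟩ := exists_subset_forall_ncard_image_lt hfin hcon d le_rfl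
  have hTfin := hfin.subset hTS
  have hTlow : N ^ (ε / 2) ≤ (T.ncard : ℝ) :=
    hlow.trans (le_trans (by gcongr) hT)
  have hTne : T.Nonempty := by
    rw [← Set.ncard_pos hTfin]
    exact_mod_cast (Real.rpow_pos_of_pos hN0 _).trans_le hTlow
  have hTup : (T.ncard : ℝ) ≤
      ∏ i, (((fun x : Fin d → G.Oring => x i) '' T).ncard : ℝ) := by
    exact_mod_cast hTfin.ncard_le_prod_ncard_image
  have hlt : ∏ i, (((fun x : Fin d → G.Oring => x i) '' T).ncard : ℝ) <
      ∏ _i : Fin d, N ^ (ε / (2 * (d : ℝ))) := by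
    refine Finset.prod_lt_prod_of_nonempty (fun i _ => ?_) (fun i _ => hproj i i.2)
      ⟨⟨0, hd0⟩, Finset.mem_univ _⟩
    exact_mod_cast (Set.ncard_pos (hTfin.image _)).mpr (hTne.image _)
  have hQ : ∏ _i : Fin d, N ^ (ε / (2 * (d : ℝ))) = N ^ (ε / 2) := by
    rw [Finset.prod_const, Finset.card_univ, Fintype.card_fin, ← Real.rpow_natCast,
      ← Real.rpow_mul hN0.le]
    congr 1
    field_simp
  linarith
end
end

section
/- Let K be a global field with ring of integers O_K, let X be a nonempty finite set of elements of O_K, let P be a finite set of primes of O_K, and for each 𝔭 ∈ P let ℰ(𝔭) ⊆ O_K/𝔭 be a set of residue classes. Suppose that every x ∈ X satisfies Σ_{𝔭∈P} 1_{x mod 𝔭 ∈ ℰ(𝔭)}·log(N_K(𝔭))/N_K(𝔭) ≥ (1/2)·w(P). Then the set P₁ := {𝔭 ∈ P : |{x ∈ X : x mod 𝔭 ∈ ℰ(𝔭)}| ≥ |X|/4} satisfies w(P₁) ≥ (1/4)·w(P). -/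
open scoped BigOperators

noncomputable section

/-- Weighted pigeonhole: if every `x ∈ X` is related to at least half of `P` by weight, then at
least a quarter of `P` by weight is related to at least a quarter of `X`. -/
theorem Finset.sum_div_four_le_sum_filter_of_half_le {α β : Type*} (X : Finset α)
    (hX : X.Nonempty) (P : Finset β) (c : β → ℝ) (hc : ∀ p ∈ P, 0 ≤ c p)
    (r : α → β → Prop) [∀ x p, Decidable (r x p)]
    [DecidablePred fun p => (X.card : ℝ) / 4 ≤ ((X.filter fun x => r x p).card : ℝ)]
    (h : ∀ x ∈ X, (∑ p ∈ P, c p) / 2 ≤ ∑ p ∈ P, if r x p then c p else 0) :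
    (∑ p ∈ P, c p) / 4 ≤
      ∑ p ∈ P.filter fun p => (X.card : ℝ) / 4 ≤ ((X.filter fun x => r x p).card : ℝ), c p := by
  have hcard : (0 : ℝ) < X.card := by exact_mod_cast hX.card_pos
  have hdouble : (X.card : ℝ) * ((∑ p ∈ P, c p) / 2) ≤
      ∑ p ∈ P, ((X.filter fun x => r x p).card : ℝ) * c p := by
    calc (X.card : ℝ) * ((∑ p ∈ P, c p) / 2) = ∑ _x ∈ X, (∑ p ∈ P, c p) / 2 := by
          rw [Finset.sum_const, nsmul_eq_mul]
      _ ≤ ∑ x ∈ X, ∑ p ∈ P, if r x p then c p else 0 := Finset.sum_le_sum h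
      _ = ∑ p ∈ P, ((X.filter fun x => r x p).card : ℝ) * c p := by
          rw [Finset.sum_comm]
          refine Finset.sum_congr rfl fun p _ => ?_
          rw [← Finset.sum_filter, Finset.sum_const, nsmul_eq_mul]
  have hpoint : ∑ p ∈ P, ((X.filter fun x => r x p).card : ℝ) * c p ≤
      ∑ p ∈ P, (X.card : ℝ) * (c p / 4 + 3 / 4 *
        if (X.card : ℝ) / 4 ≤ ((X.filter fun x => r x p).card : ℝ) then c p else 0) := by
    refine Finset.sum_le_sum fun p hp => ?_
    split_ifs with hr
    · have hle : ((X.filter fun x => r x p).card : ℝ) ≤ X.card := by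
        exact_mod_cast Finset.card_filter_le X _
      nlinarith [mul_le_mul_of_nonneg_right hle (hc p hp)]
    · nlinarith [mul_le_mul_of_nonneg_right (not_le.mp hr).le (hc p hp)]
  have hnonneg : 0 ≤ ∑ p ∈ P, c p := Finset.sum_nonneg hc
  rw [← Finset.mul_sum, Finset.sum_add_distrib, ← Finset.sum_div, ← Finset.mul_sum,
    ← Finset.sum_filter] at hpoint
  have := le_of_mul_le_mul_left (hdouble.trans hpoint) hcard
  linarith

theorem GlobalFieldData.w_coe_finset (G : GlobalFieldData) (P : Finset G.Primes) :
    G.w ↑P = ∑ p ∈ P, Real.log (G.normP p : ℝ) / (G.normP p : ℝ) :=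
  finsum_mem_coe_finset _ P


open GlobalFieldData in
open scoped Classical in
/-- **Claim 5.7**: if every `x ∈ X` lies in the exceptional residue classes
`ℰ(𝔭)` for a weighted half of the primes `𝔭 ∈ P`, then for a weighted quarter of
the primes of `P` at least a quarter of the elements of `X` reduce into `ℰ(𝔭)`. -/
theorem exceptional_primes_claim (G : GlobalFieldData)
    (X : Finset G.Oring) (hX : X.Nonempty) (P : Finset G.Primes)
    (E : ∀ p : G.Primes, Set (G.Oring ⧸ p.1))
    (hyp : ∀ x ∈ X,
      G.w ↑P / 2 ≤ ∑ p ∈ P, (if Ideal.Quotient.mk p.1 x ∈ E p then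
        Real.log (G.normP p : ℝ) / (G.normP p : ℝ) else 0)) :
    G.w ↑P / 4 ≤
      G.w {p : G.Primes | p ∈ P ∧
        (X.card : ℝ) / 4
          ≤ ((X.filter fun x => Ideal.Quotient.mk p.1 x ∈ E p).card : ℝ)} := by
  have hfilter : {p : G.Primes | p ∈ P ∧ (X.card : ℝ) / 4
      ≤ ((X.filter fun x => Ideal.Quotient.mk p.1 x ∈ E p).card : ℝ)} =
      ↑(P.filter fun p => (X.card : ℝ) / 4
        ≤ ((X.filter fun x => Ideal.Quotient.mk p.1 x ∈ E p).card : ℝ)) :=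
    (Finset.coe_filter _ P).symm
  rw [w_coe_finset] at hyp
  rw [hfilter, w_coe_finset, w_coe_finset]
  exact Finset.sum_div_four_le_sum_filter_of_half_le X hX P _
    (fun p _ => div_nonneg (Real.log_natCast_nonneg _) (Nat.cast_nonneg _)) _ hyp
end
end
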